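/- (Duality for subprobability Wasserstein distance carried by cemetery extension.) Let (E,d) be a Polish space with base point z_0, and extend to Ē = E ∪ {∂} with d(z,∂) := d(z,z_0)+1. For subprobability measures μ, ν on E with finite first moments, define μ̄ := μ + (1−μ(E))δ_∂ and ν̄ := ν + (1−ν(E))δ_∂, and d'_1(μ,ν) := d_1(μ̄, ν̄) (Wasserstein-1 on Ē). Then d'_1(μ,ν) = sup{ μ(φ) − ν(φ) : φ : E → ℝ 1-Lipschitz, φ(z_0)=0 } + |μ(E) − ν(E)|. -/

import Mathlib

open MeasureTheory Set

/-- The Borel-type σ-algebra on `Option E`, induced from `E ⊕ PUnit`. -/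
instance optionMeasurableSpace {E : Type*} [MeasurableSpace E] :
    MeasurableSpace (Option E) :=
  MeasurableSpace.comap (Equiv.optionEquivSumPUnit.{0} E)
    (inferInstance : MeasurableSpace (E ⊕ PUnit))

/-- The distance on the cemetery-extended space `Ē = E ∪ {∂}` (`∂` encoded as `none`),
with `d(z,∂) = d(z,z₀) + 1`. -/
noncomputable def cemeteryDist {E : Type*} [MetricSpace E] (z0 : E) :
    Option E → Option E → ℝ
  | none, none => 0
  | none, some z => dist z z0 + 1
  | some z, none => dist z z0 + 1
  | some z, some w => dist z w

/-- The extension `μ̄ = μ + (1 − μ(E)) δ_∂` of a subprobability measure `μ` on `E` to `Ē`. -/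
noncomputable def cemeteryExtension {E : Type*} [MeasurableSpace E] (μ : Measure E) :
    Measure (Option E) :=
  Measure.map some μ + (1 - μ Set.univ) • Measure.dirac none

/-- The Wasserstein-1 distance on `Ē`, defined as the infimum of transport costs over
couplings. -/
noncomputable def wasserstein1 {E : Type*} [MeasurableSpace E] [MetricSpace E] (z0 : E)
    (κ ν : Measure (Option E)) : ℝ :=
  sInf {r | ∃ π : Measure (Option E × Option E),
    π.map Prod.fst = κ ∧ π.map Prod.snd = ν ∧
      r = ∫ q, cemeteryDist z0 q.1 q.2 ∂π}

/-- Kantorovich duality for a finite transport problem, with an `ε`-optimal dual pair. -/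
theorem exists_finite_transport_plan {ι : Type*} [Fintype ι] [Nonempty ι] (P Q : ι → ℝ)
    (hP : ∀ i, 0 ≤ P i) (hQ : ∀ i, 0 ≤ Q i) (hP1 : ∑ i, P i = 1) (hQ1 : ∑ i, Q i = 1)
    (C : ι → ι → ℝ) {ε : ℝ} (hε : 0 < ε) :
    ∃ γ : ι → ι → ℝ, (∀ i j, 0 ≤ γ i j) ∧ (∀ i, ∑ j, γ i j = P i) ∧
      (∀ j, ∑ i, γ i j = Q j) ∧
      ∃ φ ψ : ι → ℝ, (∀ i j, φ i + ψ j ≤ C i j) ∧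
        ∑ i, ∑ j, γ i j * C i j ≤ ∑ i, P i * φ i + ∑ j, Q j * ψ j + ε := by
  classical
  let A : (ι → ι → ℝ) → Set ℝ := fun h =>
    {r | ∃ φ ψ : ι → ℝ, (∀ i j, h i j ≤ φ i + ψ j) ∧
      r = ∑ i, P i * φ i + ∑ j, Q j * ψ j}
  let p : (ι → ι → ℝ) → ℝ := fun h => sInf (A h)
  have hlow : ∀ h, ∀ r ∈ A h, ∑ i, ∑ j, P i * Q j * h i j ≤ r := by
    rintro h r ⟨φ, ψ, hle, rfl⟩
    calc ∑ i, ∑ j, P i * Q j * h i j ≤ ∑ i, ∑ j, P i * Q j * (φ i + ψ j) := by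
          gcongr with i _ j _
          · exact mul_nonneg (hP i) (hQ j)
          · exact hle i j
      _ = (∑ i, P i * φ i) * (∑ j, Q j) + (∑ i, P i) * ∑ j, Q j * ψ j := by
          rw [Finset.sum_mul_sum, Finset.sum_mul_sum, ← Finset.sum_add_distrib]
          refine Finset.sum_congr rfl fun i _ => ?_
          rw [← Finset.sum_add_distrib]
          exact Finset.sum_congr rfl fun j _ => by ring
      _ = _ := by rw [hP1, hQ1]; ring
  have hbdd : ∀ h, BddBelow (A h) := fun h => ⟨_, hlow h⟩
  have hne : ∀ h, (A h).Nonempty := by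
    intro h
    refine ⟨_, fun i => ∑ j, |h i j|, 0, fun i j => ?_, rfl⟩
    simpa using (le_abs_self _).trans
      (Finset.single_le_sum (f := fun j => |h i j|) (fun _ _ => abs_nonneg _) (Finset.mem_univ j))
  have hple : ∀ h (φ ψ : ι → ℝ), (∀ i j, h i j ≤ φ i + ψ j) →
      p h ≤ ∑ i, P i * φ i + ∑ j, Q j * ψ j := fun h φ ψ hle =>
    csInf_le (hbdd h) ⟨φ, ψ, hle, rfl⟩
  have hhom_le : ∀ t : ℝ, 0 < t → ∀ h, p (t • h) ≤ t * p h := by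
    intro t ht h
    rw [← div_le_iff₀' ht]
    refine le_csInf (hne h) ?_
    rintro r ⟨φ, ψ, hle, rfl⟩
    rw [div_le_iff₀' ht]
    refine (hple _ (t • φ) (t • ψ) fun i j => ?_).trans_eq ?_
    · simpa [mul_add] using mul_le_mul_of_nonneg_left (hle i j) ht.le
    · simp only [Pi.smul_apply, smul_eq_mul, mul_add, Finset.mul_sum, mul_left_comm]
  have hhom : ∀ t : ℝ, 0 < t → ∀ h, p (t • h) = t * p h := by
    intro t ht h
    refine (hhom_le t ht h).antisymm ?_
    have := hhom_le t⁻¹ (inv_pos.2 ht) (t • h)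
    rwa [inv_smul_smul₀ ht.ne', ← div_eq_inv_mul, le_div_iff₀' ht] at this
  have hadd : ∀ h k, p (h + k) ≤ p h + p k := by
    intro h k
    rw [← sub_le_iff_le_add]
    refine le_csInf (hne h) ?_
    rintro r ⟨φ, ψ, hle, rfl⟩
    rw [sub_le_comm]
    refine le_csInf (hne k) ?_
    rintro s ⟨φ', ψ', hle', rfl⟩
    rw [sub_le_iff_le_add]
    refine (hple _ (φ + φ') (ψ + ψ') fun i j => ?_).trans_eq ?_
    · simpa [add_add_add_comm] using add_le_add (hle i j) (hle' i j)
    · simp only [Pi.add_apply, mul_add, Finset.sum_add_distrib]; ring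
  have hp0 : p 0 = 0 := by
    refine le_antisymm (by simpa using hple 0 0 0 (by simp)) ?_
    exact le_csInf (hne 0) fun r hr => by simpa using hlow 0 r hr
  have hH : ∀ t : ℝ, t • (-C) = 0 → t • p (-C) = 0 := by
    intro t ht
    rcases smul_eq_zero.1 ht with h | h
    · simp [h]
    · simp [h, hp0]
  obtain ⟨g, hg, hgp⟩ := exists_extension_of_le_sublinear
    (LinearPMap.mkSpanSingleton' (-C) (p (-C)) hH) p hhom hadd (by
      rintro ⟨x, hx⟩
      obtain ⟨t, rfl⟩ := Submodule.mem_span_singleton.1 hx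
      rw [LinearPMap.mkSpanSingleton'_apply]
      rcases lt_trichotomy t 0 with ht | rfl | ht
      · have h1 := hadd (t • -C) ((-t) • -C)
        rw [← add_smul, add_neg_cancel, zero_smul, hp0, hhom (-t) (by linarith)] at h1
        simp only [RingHom.id_apply, smul_eq_mul]
        linarith
      · simp [hp0]
      · rw [hhom t ht]; rfl)
  have hgC : g (-C) = p (-C) := by
    have := hg ⟨(1 : ℝ) • -C, Submodule.mem_span_singleton.2 ⟨1, rfl⟩⟩
    simpa using this.trans (LinearPMap.mkSpanSingleton'_apply _ _ hH 1 _)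
  let e : ι → ι → (ι → ι → ℝ) := fun i j => Pi.single i (Pi.single j 1)
  have hgsum : ∀ h, g h = ∑ i, ∑ j, g (e i j) * h i j := by
    intro h
    have : h = ∑ i, ∑ j, h i j • e i j := by
      funext a b
      simp [e, Finset.sum_apply, Pi.single_apply, ite_apply]
    conv_lhs => rw [this]
    simp [map_sum, mul_comm]
  have hgprod : ∀ φ ψ : ι → ℝ, g (fun i j => φ i + ψ j) = ∑ i, P i * φ i + ∑ j, Q j * ψ j := by
    intro φ ψ
    refine le_antisymm ((hgp _).trans (hple _ φ ψ fun _ _ => le_rfl)) ?_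
    have h1 := (hgp (-fun i j => φ i + ψ j)).trans (hple _ (-φ) (-ψ) fun i j => by simp [add_comm])
    simp only [map_neg, Pi.neg_apply, mul_neg, Finset.sum_neg_distrib] at h1
    linarith
  refine ⟨fun i j => g (e i j), fun i j => ?_, fun i => ?_, fun j => ?_, ?_⟩
  · have := (hgp (-e i j)).trans (hple _ 0 0 fun a b => by
      simp only [e, Pi.neg_apply, Pi.single_apply, ite_apply, Pi.zero_apply]
      split_ifs <;> simp)
    simpa using this
  · have := hgprod (Pi.single i 1) 0
    rw [hgsum] at this
    simpa [Pi.single_apply] using this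
  · have := hgprod 0 (Pi.single j 1)
    rw [hgsum] at this
    simpa [Pi.single_apply] using this
  · obtain ⟨r, ⟨φ, ψ, hle, rfl⟩, hr⟩ := exists_lt_of_csInf_lt (hne (-C))
      (show sInf (A (-C)) < p (-C) + ε by simpa [p] using hε)
    refine ⟨-φ, -ψ, fun i j => ?_, ?_⟩
    · have := hle i j
      simp only [Pi.neg_apply] at this ⊢
      linarith
    · rw [← hgsum C]
      rw [← hgC, map_neg] at hr
      simp only [Pi.neg_apply, mul_neg, Finset.sum_neg_distrib]
      linarith

/-- A finite transport plan between the masses that two probability measures give to the cells of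
a finite partition lifts to a coupling of the two measures. -/
theorem exists_coupling_of_finite_plan {X ι : Type*} [MeasurableSpace X] [Fintype ι]
    (κ ν : Measure X) [IsProbabilityMeasure κ] [IsProbabilityMeasure ν]
    (S : X → ι) (hS : ∀ i, MeasurableSet (S ⁻¹' {i})) (γ : ι → ι → ℝ) (hγ : ∀ i j, 0 ≤ γ i j)
    (hrow : ∀ i, ∑ j, γ i j = κ.real (S ⁻¹' {i}))
    (hcol : ∀ j, ∑ i, γ i j = ν.real (S ⁻¹' {j})) :
    ∃ π : Measure (X × X), π.map Prod.fst = κ ∧ π.map Prod.snd = ν ∧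
      ∀ i j, π.real ((S ⁻¹' {i}) ×ˢ (S ⁻¹' {j})) = γ i j := by
  classical
  have hγκ : ∀ i j, γ i j ≤ κ.real (S ⁻¹' {i}) := fun i j =>
    (Finset.single_le_sum (f := fun j => γ i j) (fun j _ => hγ i j) (Finset.mem_univ j)).trans_eq
      (hrow i)
  have hγν : ∀ i j, γ i j ≤ ν.real (S ⁻¹' {j}) := fun i j =>
    (Finset.single_le_sum (f := fun i => γ i j) (fun i _ => hγ i j) (Finset.mem_univ i)).trans_eq
      (hcol j)
  let w : ι → ι → ℝ := fun i j => γ i j / (κ.real (S ⁻¹' {i}) * ν.real (S ⁻¹' {j}))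
  have hw0 : ∀ i j, 0 ≤ w i j := fun i j => div_nonneg (hγ i j) (by positivity)
  have hw : ∀ i j, w i j * (κ.real (S ⁻¹' {i}) * ν.real (S ⁻¹' {j})) = γ i j := by
    intro i j
    refine div_mul_cancel_of_imp fun h => ?_
    rcases mul_eq_zero.1 h with h | h
    · exact le_antisymm (h ▸ hγκ i j) (hγ i j)
    · exact le_antisymm (h ▸ hγν i j) (hγ i j)
  have hsum : ∀ (ρ : Measure X) [IsProbabilityMeasure ρ] (B : Set X), MeasurableSet B →
      ∑ i, ρ.real (B ∩ S ⁻¹' {i}) = ρ.real B := by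
    intro ρ _ B hB
    rw [← measureReal_biUnion_finset]
    · congr 1
      ext x
      simp
    · intro i _ j _ hij
      refine Set.disjoint_left.2 fun x hx hx' => hij ?_
      simpa using hx.2.symm.trans hx'.2
    · exact fun i _ => hB.inter (hS i)
  let π : Measure (X × X) := ∑ i, ∑ j, (w i j).toNNReal •
    ((κ.restrict (S ⁻¹' {i})).prod (ν.restrict (S ⁻¹' {j})))
  have hπ : ∀ B D : Set X, MeasurableSet B → MeasurableSet D → π.real (B ×ˢ D) =
      ∑ i, ∑ j, w i j * (κ.real (B ∩ S ⁻¹' {i}) * ν.real (D ∩ S ⁻¹' {j})) := by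
    intro B D hB hD
    simp only [π, Measure.real, Measure.finsetSum_apply, Measure.coe_nnreal_smul_apply]
    rw [ENNReal.toReal_sum (by simp [ENNReal.mul_eq_top, ENNReal.sum_eq_top])]
    refine Finset.sum_congr rfl fun i _ => ?_
    rw [ENNReal.toReal_sum (by simp [ENNReal.mul_eq_top])]
    refine Finset.sum_congr rfl fun j _ => ?_
    simp [Measure.restrict_apply hB, Measure.restrict_apply hD, hw0]
  have hπfin : IsFiniteMeasure π := by
    simp only [π]
    infer_instance
  refine ⟨π, ?_, ?_, fun a b => ?_⟩
  · have : IsFiniteMeasure (π.map Prod.fst) := inferInstance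
    refine Measure.ext fun B hB => ?_
    rw [← measureReal_eq_measureReal_iff, map_measureReal_apply measurable_fst hB,
      ← Set.prod_univ, hπ B univ hB .univ, ← hsum κ B hB]
    refine Finset.sum_congr rfl fun i _ => ?_
    simp only [univ_inter]
    rcases eq_or_ne (κ.real (S ⁻¹' {i})) 0 with h | h
    · have : κ.real (B ∩ S ⁻¹' {i}) = 0 :=
        le_antisymm (h ▸ measureReal_mono inter_subset_right) measureReal_nonneg
      simp [this]
    · refine mul_right_cancel₀ h ?_
      rw [Finset.sum_mul]
      conv_rhs => rw [← hrow i, Finset.mul_sum]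
      refine Finset.sum_congr rfl fun j _ => ?_
      rw [← hw i j]; ring
  · have : IsFiniteMeasure (π.map Prod.snd) := inferInstance
    refine Measure.ext fun B hB => ?_
    rw [← measureReal_eq_measureReal_iff, map_measureReal_apply measurable_snd hB,
      ← Set.univ_prod, hπ univ B .univ hB, ← hsum ν B hB, Finset.sum_comm]
    refine Finset.sum_congr rfl fun i _ => ?_
    simp only [univ_inter]
    rcases eq_or_ne (ν.real (S ⁻¹' {i})) 0 with h | h
    · have : ν.real (B ∩ S ⁻¹' {i}) = 0 :=
        le_antisymm (h ▸ measureReal_mono inter_subset_right) measureReal_nonneg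
      simp [this]
    · refine mul_right_cancel₀ h ?_
      rw [Finset.sum_mul]
      conv_rhs => rw [← hcol i, Finset.mul_sum]
      refine Finset.sum_congr rfl fun j _ => ?_
      rw [← hw j i]; ring
  · have hinter : ∀ i j, i ≠ j → S ⁻¹' {i} ∩ S ⁻¹' {j} = ∅ := by
      intro i j hij
      ext x
      simp only [mem_inter_iff, mem_preimage, mem_singleton_iff, mem_empty_iff_false, iff_false]
      rintro ⟨rfl, h⟩
      exact hij h
    rw [hπ _ _ (hS a) (hS b), Finset.sum_eq_single a, Finset.sum_eq_single b]
    · simp [hw]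
    · intro j _ hj
      simp [hinter b j hj.symm]
    · simp
    · intro i _ hi
      simp [hinter a i hi.symm]
    · simp

/-- Approximate Kantorovich–Rubinstein duality for a measurable pseudometric `c`: if the two
measures are transported to finitely many points at cost at most `ε`, then some coupling and some
`c`-Lipschitz function agree up to `5 * ε`. -/
theorem exists_coupling_le_lipschitz_add {X ι : Type*} [MeasurableSpace X] [Fintype ι]
    (c : X → X → ℝ) (hc0 : ∀ x, c x x = 0) (hcsymm : ∀ x y, c x y = c y x)
    (hctri : ∀ x y z, c x z ≤ c x y + c y z)
    (hcmeas : Measurable fun q : X × X => c q.1 q.2)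
    (κ ν : Measure X) [IsProbabilityMeasure κ] [IsProbabilityMeasure ν]
    (S : X → ι) (hS : ∀ i, MeasurableSet (S ⁻¹' {i})) (p : ι → X) {ε : ℝ} (hε : 0 < ε)
    (hκint : Integrable (fun x => c x (p (S x))) κ) (hκ : ∫ x, c x (p (S x)) ∂κ ≤ ε)
    (hνint : Integrable (fun x => c x (p (S x))) ν) (hν : ∫ x, c x (p (S x)) ∂ν ≤ ε) :
    ∃ π : Measure (X × X), π.map Prod.fst = κ ∧ π.map Prod.snd = ν ∧
      ∃ f : X → ℝ, (∀ x y, f x - f y ≤ c x y) ∧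
        ∫ q, c q.1 q.2 ∂π ≤ ∫ x, f x ∂κ - ∫ x, f x ∂ν + 5 * ε := by
  classical
  have hnonneg : ∀ x y, 0 ≤ c x y := fun x y => by
    have := hctri x y x
    rw [hc0, hcsymm y x] at this
    linarith
  let _ : MeasurableSpace ι := ⊤
  have hSm : Measurable S := measurable_to_countable' hS
  obtain ⟨x0⟩ : Nonempty X := nonempty_of_isProbabilityMeasure κ
  have : Nonempty ι := ⟨S x0⟩
  have hmass : ∀ (ρ : Measure X) [IsProbabilityMeasure ρ] (u : ι → ℝ),
      ∫ x, u (S x) ∂ρ = ∑ i, ρ.real (S ⁻¹' {i}) * u i := by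
    intro ρ _ u
    have : IsProbabilityMeasure (ρ.map S) := Measure.isProbabilityMeasure_map hSm.aemeasurable
    rw [← integral_map hSm.aemeasurable (Measurable.of_discrete).aestronglyMeasurable,
      integral_fintype (.of_finite)]
    simp [map_measureReal_apply hSm]
  have hone : ∀ (ρ : Measure X) [IsProbabilityMeasure ρ], ∑ i, ρ.real (S ⁻¹' {i}) = 1 := by
    intro ρ _
    simpa using (hmass ρ fun _ => 1).symm
  obtain ⟨γ, hγ, hrow, hcol, φ, ψ, hφψ, hcost⟩ := exists_finite_transport_plan
    (fun i => κ.real (S ⁻¹' {i})) (fun j => ν.real (S ⁻¹' {j})) (fun _ => measureReal_nonneg)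
    (fun _ => measureReal_nonneg) (hone κ) (hone ν) (fun i j => c (p i) (p j)) hε
  obtain ⟨π, hπ1, hπ2, hπγ⟩ := exists_coupling_of_finite_plan κ ν S hS γ hγ hrow hcol
  let f : X → ℝ := fun x => Finset.univ.inf' Finset.univ_nonempty fun j => c x (p j) - ψ j
  have hfle : ∀ x j, f x ≤ c x (p j) - ψ j := fun x j =>
    Finset.inf'_le _ (Finset.mem_univ j)
  have hf : ∀ x y, f x - f y ≤ c x y := by
    intro x y
    obtain ⟨j, -, hj⟩ := Finset.exists_mem_eq_inf' Finset.univ_nonempty fun j => c y (p j) - ψ j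
    have h1 : f y = c y (p j) - ψ j := hj
    linarith [hfle x j, hctri x y (p j)]
  have hfφ : ∀ i, φ i ≤ f (p i) := fun i =>
    Finset.le_inf' _ _ fun j _ => by linarith [hφψ i j]
  have hfψ : ∀ j, f (p j) ≤ -ψ j := fun j => by simpa [hc0] using hfle (p j) j
  have hfmeas : Measurable f := by
    have : f = Finset.univ.inf' Finset.univ_nonempty fun j x => c x (p j) - ψ j := by
      ext x; simp [f, Finset.inf'_apply]
    rw [this]
    refine Finset.inf'_induction _ _ (fun _ h _ h' => h.inf h') fun j _ => ?_
    exact (hcmeas.comp (measurable_id.prodMk measurable_const)).sub_const _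
  have hdisc : ∀ (ρ : Measure X) [IsProbabilityMeasure ρ] (u : ι → ℝ),
      Integrable (fun x => u (S x)) ρ := by
    intro ρ _ u
    have : IsProbabilityMeasure (ρ.map S) := Measure.isProbabilityMeasure_map hSm.aemeasurable
    exact (Integrable.of_finite (μ := ρ.map S) (f := u)).comp_measurable hSm
  have hfint : ∀ (ρ : Measure X) [IsProbabilityMeasure ρ],
      Integrable (fun x => c x (p (S x))) ρ → Integrable f ρ := by
    intro ρ _ hρ
    refine Integrable.mono' (hρ.add (hdisc ρ fun i => |f (p i)|)) hfmeas.aestronglyMeasurable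
      (.of_forall fun x => ?_)
    simp only [Real.norm_eq_abs, Pi.add_apply]
    rw [← sub_le_iff_le_add]
    refine (abs_sub_abs_le_abs_sub _ _).trans (abs_le.2 ⟨?_, hf _ _⟩)
    linarith [hf (p (S x)) x, hcsymm x (p (S x))]
  have hκf : ∑ i, κ.real (S ⁻¹' {i}) * φ i ≤ ∫ x, f x ∂κ + ε := by
    rw [← hmass κ φ]
    calc ∫ x, φ (S x) ∂κ ≤ ∫ x, (f x + c x (p (S x))) ∂κ := by
          refine integral_mono (hdisc κ φ) ((hfint κ hκint).add hκint) fun x => ?_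
          dsimp only
          linarith [hf (p (S x)) x, hfφ (S x), hcsymm x (p (S x))]
      _ ≤ _ := by rw [integral_add (hfint κ hκint) hκint]; linarith
  have hνf : ∑ j, ν.real (S ⁻¹' {j}) * ψ j ≤ -∫ x, f x ∂ν + ε := by
    rw [← hmass ν ψ]
    calc ∫ x, ψ (S x) ∂ν ≤ ∫ x, (-f x + c x (p (S x))) ∂ν := by
          refine integral_mono (hdisc ν ψ) ((hfint ν hνint).neg.add hνint) fun x => ?_
          dsimp only
          linarith [hf x (p (S x)), hfψ (S x)]
      _ ≤ _ := by
          rw [integral_add (f := fun x => -f x) (hfint ν hνint).neg hνint, integral_neg]; linarith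
  have hπprob : IsProbabilityMeasure π := by
    refine ⟨?_⟩
    have := congrArg (fun m => m univ) hπ1
    simpa [Measure.map_apply measurable_fst] using this
  have hSS : Measurable fun q : X × X => (S q.1, S q.2) :=
    (hSm.comp measurable_fst).prodMk (hSm.comp measurable_snd)
  have hi1 : Integrable (fun q : X × X => c q.1 (p (S q.1))) π := by
    rw [← hπ1] at hκint
    exact hκint.comp_measurable measurable_fst
  have hi2 : Integrable (fun q : X × X => c q.2 (p (S q.2))) π := by
    rw [← hπ2] at hνint
    exact hνint.comp_measurable measurable_snd
  have he1 : ∫ q, c q.1 (p (S q.1)) ∂π = ∫ x, c x (p (S x)) ∂κ := by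
    rw [← hπ1] at hκint ⊢
    exact (integral_map measurable_fst.aemeasurable hκint.aestronglyMeasurable).symm
  have he2 : ∫ q, c q.2 (p (S q.2)) ∂π = ∫ x, c x (p (S x)) ∂ν := by
    rw [← hπ2] at hνint ⊢
    exact (integral_map measurable_snd.aemeasurable hνint.aestronglyMeasurable).symm
  have hprob' : IsProbabilityMeasure (π.map fun q : X × X => (S q.1, S q.2)) :=
    Measure.isProbabilityMeasure_map hSS.aemeasurable
  have hi3 : Integrable (fun q : X × X => c (p (S q.1)) (p (S q.2))) π :=
    (Integrable.of_finite (μ := π.map fun q : X × X => (S q.1, S q.2))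
      (f := fun r : ι × ι => c (p r.1) (p r.2))).comp_measurable hSS
  have he3 : ∫ q, c (p (S q.1)) (p (S q.2)) ∂π = ∑ i, ∑ j, γ i j * c (p i) (p j) := by
    rw [← integral_map (f := fun r : ι × ι => c (p r.1) (p r.2)) hSS.aemeasurable
      (Measurable.of_discrete).aestronglyMeasurable, integral_fintype (.of_finite),
      Fintype.sum_prod_type]
    refine Finset.sum_congr rfl fun i _ => Finset.sum_congr rfl fun j _ => ?_
    rw [map_measureReal_apply hSS (MeasurableSet.of_discrete), ← hπγ i j, smul_eq_mul]
    congr 2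
    ext q
    simp
  have hle : ∫ q, c q.1 q.2 ∂π ≤
      ∫ q, (c q.1 (p (S q.1)) + c (p (S q.1)) (p (S q.2)) + c q.2 (p (S q.2))) ∂π := by
    refine integral_mono_of_nonneg (.of_forall fun q => hnonneg _ _) ((hi1.add hi3).add hi2)
      (.of_forall fun q => ?_)
    dsimp only
    linarith [hctri q.1 (p (S q.1)) q.2, hctri (p (S q.1)) (p (S q.2)) q.2,
      hcsymm q.2 (p (S q.2))]
  rw [integral_add (f := fun q => c q.1 (p (S q.1)) + c (p (S q.1)) (p (S q.2)))
    (hi1.add hi3) hi2, integral_add hi1 hi3, he1, he2, he3] at hle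
  exact ⟨π, hπ1, hπ2, f, hf, by linarith⟩

theorem measurableSet_option_iff {E : Type*} [MeasurableSpace E] {s : Set (Option E)} :
    MeasurableSet s ↔ MeasurableSet (some ⁻¹' s) := by
  constructor
  · rintro ⟨t, ht, rfl⟩
    exact (measurableSet_sum_iff.1 ht).1
  · intro h
    refine ⟨(Equiv.optionEquivSumPUnit.{0} E).symm ⁻¹' s,
      measurableSet_sum_iff.2 ⟨h, .of_discrete⟩, ?_⟩
    ext x
    simp

theorem measurable_option_some {E : Type*} [MeasurableSpace E] :
    Measurable (some : E → Option E) := fun _ hs => measurableSet_option_iff.1 hs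

theorem measurable_of_comp_some {E β : Type*} [MeasurableSpace E] [MeasurableSpace β]
    {f : Option E → β} (hf : Measurable fun z => f (some z)) : Measurable f := fun _ hs =>
  measurableSet_option_iff.2 (hf hs)

section cemeteryDist

variable {E : Type*} [MetricSpace E] (z0 : E)

theorem cemeteryDist_eq (a b : Option E) :
    cemeteryDist z0 a b = dist (a.getD z0) (b.getD z0) +
      |(a.elim 1 fun _ => 0) - (b.elim 1 fun _ => 0 : ℝ)| := by
  cases a <;> cases b <;> simp [cemeteryDist, dist_comm]

theorem cemeteryDist_self (a : Option E) : cemeteryDist z0 a a = 0 := by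
  simp [cemeteryDist_eq]

theorem cemeteryDist_comm (a b : Option E) : cemeteryDist z0 a b = cemeteryDist z0 b a := by
  rw [cemeteryDist_eq, cemeteryDist_eq, dist_comm, abs_sub_comm]

theorem cemeteryDist_triangle (a b c : Option E) :
    cemeteryDist z0 a c ≤ cemeteryDist z0 a b + cemeteryDist z0 b c := by
  simp only [cemeteryDist_eq]
  linarith [dist_triangle (a.getD z0) (b.getD z0) (c.getD z0),
    abs_sub_le (a.elim 1 fun _ => 0 : ℝ) (b.elim 1 fun _ => 0) (c.elim 1 fun _ => 0)]

theorem cemeteryDist_nonneg (a b : Option E) : 0 ≤ cemeteryDist z0 a b := by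
  rw [cemeteryDist_eq]
  positivity

theorem measurable_cemeteryDist [MeasurableSpace E] [BorelSpace E] [SecondCountableTopology E] :
    Measurable fun q : Option E × Option E => cemeteryDist z0 q.1 q.2 := by
  have hg : Measurable fun a : Option E => a.getD z0 := measurable_of_comp_some measurable_id
  have hn : Measurable fun a : Option E => (a.elim 1 fun _ => 0 : ℝ) :=
    measurable_of_comp_some measurable_const
  simp only [cemeteryDist_eq]
  exact ((hg.comp measurable_fst).dist (hg.comp measurable_snd)).add
    (((hn.comp measurable_fst).sub (hn.comp measurable_snd)).abs)

end cemeteryDist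

section cemeteryExtension

variable {E : Type*} [MeasurableSpace E] (μ : Measure E)

theorem isProbabilityMeasure_cemeteryExtension (hμ : μ univ ≤ 1) :
    IsProbabilityMeasure (cemeteryExtension μ) := by
  refine ⟨?_⟩
  simp [cemeteryExtension, Measure.map_apply measurable_option_some, add_tsub_cancel_of_le hμ]

variable {μ} {f : Option E → ℝ}

theorem integrable_cemeteryExtension (hf : Measurable f)
    (hfi : Integrable (fun z => f (some z)) μ) : Integrable f (cemeteryExtension μ) := by
  refine Integrable.add_measure ?_ (Integrable.smul_measure ?_ (by finiteness))
  · exact (integrable_map_measure hf.aestronglyMeasurable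
      measurable_option_some.aemeasurable).2 hfi
  · exact integrable_dirac' hf.stronglyMeasurable (by simp)

theorem integral_cemeteryExtension (hμ : μ univ ≤ 1) (hf : Measurable f)
    (hfi : Integrable (fun z => f (some z)) μ) :
    ∫ a, f a ∂cemeteryExtension μ = ∫ z, f (some z) ∂μ + (1 - μ.real univ) * f none := by
  have h := integrable_cemeteryExtension hf hfi
  rw [cemeteryExtension, integrable_add_measure] at h
  rw [cemeteryExtension, integral_add_measure h.1 h.2, integral_smul_measure,
    integral_map measurable_option_some.aemeasurable hf.aestronglyMeasurable,
    integral_dirac' _ _ hf.stronglyMeasurable, ENNReal.toReal_sub_of_le hμ (by simp)]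
  simp [Measure.real]

end cemeteryExtension

/-- Integrals of a `cemeteryDist`-Lipschitz function against two cemetery extensions, split into
the part vanishing at the base point and the mass defect. -/
theorem integral_cemeteryExtension_sub {E : Type*} [MeasurableSpace E] {μ ν : Measure E}
    [IsFiniteMeasure μ] [IsFiniteMeasure ν] (hμ : μ univ ≤ 1) (hν : ν univ ≤ 1)
    {f : Option E → ℝ} (hf : Measurable f) (hfμ : Integrable (fun z => f (some z)) μ)
    (hfν : Integrable (fun z => f (some z)) ν) (t : ℝ) :
    ∫ a, f a ∂cemeteryExtension μ - ∫ a, f a ∂cemeteryExtension ν =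
      (∫ z, (f (some z) - t) ∂μ - ∫ z, (f (some z) - t) ∂ν) +
        (t - f none) * (μ.real univ - ν.real univ) := by
  rw [integral_cemeteryExtension hμ hf hfμ, integral_cemeteryExtension hν hf hfν,
    integral_sub hfμ (integrable_const t), integral_sub hfν (integrable_const t)]
  simp only [integral_const, smul_eq_mul]
  ring

theorem integrable_of_lipschitzWith_one {E : Type*} [MeasurableSpace E] [MetricSpace E]
    [BorelSpace E] [SecondCountableTopology E] {z0 : E} {μ : Measure E} [IsFiniteMeasure μ]
    (hμmom : Integrable (fun z => dist z z0) μ) {φ : E → ℝ} (hφ : LipschitzWith 1 φ) :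
    Integrable φ μ := by
  refine Integrable.mono' (hμmom.add (integrable_const |φ z0|))
    hφ.continuous.measurable.aestronglyMeasurable (.of_forall fun z => ?_)
  have := hφ.dist_le_mul z z0
  rw [Real.dist_eq, NNReal.coe_one, one_mul] at this
  simp only [Real.norm_eq_abs, Pi.add_apply]
  linarith [abs_sub_abs_le_abs_sub (φ z) (φ z0)]

/-- Two measures with finite first moments are moved to a common finite set at
arbitrarily small cost. -/
theorem exists_simpleFunc_integral_dist_le {E : Type*} [MeasurableSpace E] [MetricSpace E]
    [BorelSpace E] [SecondCountableTopology E] {z0 : E} {μ ν : Measure E}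
    (hμmom : Integrable (fun z => dist z z0) μ)
    (hνmom : Integrable (fun z => dist z z0) ν) {ε : ℝ} (hε : 0 < ε) :
    ∃ T : SimpleFunc E E,
      (Integrable (fun z => dist z (T z)) μ ∧ ∫ z, dist z (T z) ∂μ ≤ ε) ∧
      (Integrable (fun z => dist z (T z)) ν ∧ ∫ z, dist z (T z) ∂ν ≤ ε) := by
  let T : ℕ → SimpleFunc E E := SimpleFunc.approxOn id measurable_id univ z0 (mem_univ z0)
  have hmeas : ∀ n, Measurable fun z => dist z (T n z) := fun n =>
    measurable_id.dist (T n).measurable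
  have hle : ∀ n z, ‖dist z (T n z)‖ ≤ dist z z0 := by
    intro n z
    have := SimpleFunc.edist_approxOn_le measurable_id (mem_univ z0) z n
    rw [edist_dist, edist_dist, ENNReal.ofReal_le_ofReal_iff dist_nonneg] at this
    rw [Real.norm_of_nonneg dist_nonneg, dist_comm, dist_comm z]
    exact this
  have hlim : ∀ z, Filter.Tendsto (fun n => dist z (T n z)) Filter.atTop (nhds 0) := by
    intro z
    have := SimpleFunc.tendsto_approxOn measurable_id (mem_univ z0) (x := z) (by simp)
    simpa using (tendsto_const_nhds (x := z)).dist this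
  have key : ∀ ρ : Measure E, Integrable (fun z => dist z z0) ρ →
      ∀ᶠ n in Filter.atTop,
        Integrable (fun z => dist z (T n z)) ρ ∧ ∫ z, dist z (T n z) ∂ρ ≤ ε := by
    intro ρ hρ
    have h := tendsto_integral_of_dominated_convergence _
      (fun n => (hmeas n).aestronglyMeasurable) hρ (fun n => .of_forall (hle n))
      (.of_forall hlim)
    rw [integral_zero] at h
    filter_upwards [h.eventually_le_const hε] with n hn
    exact ⟨hρ.mono' (hmeas n).aestronglyMeasurable (.of_forall (hle n)), hn⟩
  obtain ⟨n, hn⟩ := ((key μ hμmom).and (key ν hνmom)).exists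
  exact ⟨T n, hn⟩

theorem integral_sub_le_integral_cemeteryDist {E : Type*} [MeasurableSpace E] [MetricSpace E]
    [BorelSpace E] [SecondCountableTopology E] {z0 : E} {μ ν : Measure E}
    (hμmom : Integrable (fun z => dist z z0) μ) (hνmom : Integrable (fun z => dist z z0) ν)
    [IsFiniteMeasure μ] [IsFiniteMeasure ν] {f : Option E → ℝ} (hf : Measurable f)
    (hflip : ∀ a b, f a - f b ≤ cemeteryDist z0 a b)
    (hfμ : Integrable (fun z => f (some z)) μ) (hfν : Integrable (fun z => f (some z)) ν)
    {π : Measure (Option E × Option E)} (hπ1 : π.map Prod.fst = cemeteryExtension μ)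
    (hπ2 : π.map Prod.snd = cemeteryExtension ν) :
    ∫ a, f a ∂cemeteryExtension μ - ∫ a, f a ∂cemeteryExtension ν ≤
      ∫ q, cemeteryDist z0 q.1 q.2 ∂π := by
  have hcm : Measurable fun a => cemeteryDist z0 a none :=
    (measurable_cemeteryDist z0).comp (measurable_id.prodMk measurable_const)
  have hf1 := integrable_cemeteryExtension hf hfμ
  have hf2 := integrable_cemeteryExtension hf hfν
  have hc1 : Integrable (fun a => cemeteryDist z0 a none) (cemeteryExtension μ) :=
    integrable_cemeteryExtension hcm (hμmom.add (integrable_const 1))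
  have hc2 : Integrable (fun a => cemeteryDist z0 a none) (cemeteryExtension ν) :=
    integrable_cemeteryExtension hcm (hνmom.add (integrable_const 1))
  rw [← hπ1] at hf1 hc1 ⊢
  rw [← hπ2] at hf2 hc2 ⊢
  have hc : Integrable (fun q : Option E × Option E => cemeteryDist z0 q.1 q.2) π := by
    refine Integrable.mono' ((hc1.comp_measurable measurable_fst).add
      (hc2.comp_measurable measurable_snd)) (measurable_cemeteryDist z0).aestronglyMeasurable
      (.of_forall fun q => ?_)
    rw [Real.norm_of_nonneg (cemeteryDist_nonneg _ _ _)]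
    exact (cemeteryDist_triangle z0 q.1 none q.2).trans_eq
      (by rw [cemeteryDist_comm z0 none]; rfl)
  rw [integral_map measurable_fst.aemeasurable hf.aestronglyMeasurable,
    integral_map measurable_snd.aemeasurable hf.aestronglyMeasurable,
    ← integral_sub (f := fun q : Option E × Option E => f q.1) (g := fun q => f q.2)
      (hf1.comp_measurable measurable_fst) (hf2.comp_measurable measurable_snd)]
  exact integral_mono ((hf1.comp_measurable measurable_fst).sub
    (hf2.comp_measurable measurable_snd)) hc fun q => hflip q.1 q.2

/-- Duality for the subprobability Wasserstein distance carried by the cemetery extension: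
`d'_1(μ,ν) = sup{ μ(φ) − ν(φ) : φ 1-Lipschitz, φ(z₀) = 0 } + |μ(E) − ν(E)|`. -/
theorem stmt_17
    {E : Type*} [MeasurableSpace E] [MetricSpace E] [BorelSpace E]
    [TopologicalSpace.SeparableSpace E] [CompleteSpace E]
    (z0 : E) (μ ν : Measure E) [IsFiniteMeasure μ] [IsFiniteMeasure ν]
    (hμ : μ Set.univ ≤ 1) (hν : ν Set.univ ≤ 1)
    (hμmom : Integrable (fun z => dist z z0) μ)
    (hνmom : Integrable (fun z => dist z z0) ν) :
    wasserstein1 z0 (cemeteryExtension μ) (cemeteryExtension ν) =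
      sSup {x | ∃ φ : E → ℝ, LipschitzWith 1 φ ∧ φ z0 = 0 ∧
          x = ∫ z, φ z ∂μ - ∫ z, φ z ∂ν}
        + |(μ Set.univ).toReal - (ν Set.univ).toReal| := by
  have : SecondCountableTopology E := UniformSpace.secondCountable_of_separable E
  have := isProbabilityMeasure_cemeteryExtension μ hμ
  have := isProbabilityMeasure_cemeteryExtension ν hν
  have hlow : ∀ φ : E → ℝ, LipschitzWith 1 φ → φ z0 = 0 →
      ∀ π : Measure (Option E × Option E), π.map Prod.fst = cemeteryExtension μ →
        π.map Prod.snd = cemeteryExtension ν →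
        (∫ z, φ z ∂μ - ∫ z, φ z ∂ν) + |(μ univ).toReal - (ν univ).toReal| ≤
          ∫ q, cemeteryDist z0 q.1 q.2 ∂π := by
    intro φ hφ hφ0 π hπ1 hπ2
    obtain ⟨t, ht, htabs⟩ : ∃ t : ℝ, |t| ≤ 1 ∧
        t * (μ.real univ - ν.real univ) = |μ.real univ - ν.real univ| := by
      rcases abs_cases (μ.real univ - ν.real univ) with ⟨h, -⟩ | ⟨h, -⟩
      · exact ⟨1, by simp, by rw [h, one_mul]⟩
      · exact ⟨-1, by simp, by rw [h, neg_one_mul]⟩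
    let f : Option E → ℝ := fun a => a.elim 0 fun z => φ z + t
    have hφi := fun z w => hφ.dist_le_mul z w
    simp only [Real.dist_eq, NNReal.coe_one, one_mul] at hφi
    have hf : Measurable f := measurable_of_comp_some (hφ.continuous.measurable.add_const t)
    have hflip : ∀ a b, f a - f b ≤ cemeteryDist z0 a b := by
      rw [abs_le] at ht
      rintro (_ | z) (_ | w)
      · simp [f, cemeteryDist]
      · have := (abs_le.1 (hφi w z0)).1
        simp only [f, cemeteryDist, Option.elim]
        linarith
      · have := (abs_le.1 (hφi z z0)).2
        simp only [f, cemeteryDist, Option.elim]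
        linarith
      · have := (abs_le.1 (hφi z w)).2
        simp only [f, cemeteryDist, Option.elim]
        linarith
    have hfμ : Integrable (fun z => f (some z)) μ :=
      (integrable_of_lipschitzWith_one hμmom hφ).add (integrable_const t)
    have hfν : Integrable (fun z => f (some z)) ν :=
      (integrable_of_lipschitzWith_one hνmom hφ).add (integrable_const t)
    have := integral_sub_le_integral_cemeteryDist hμmom hνmom hf hflip hfμ hfν hπ1 hπ2
    rw [integral_cemeteryExtension_sub hμ hν hf hfμ hfν t] at this
    simp only [f, Option.elim, add_sub_cancel_right, sub_zero, htabs] at this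
    exact this
  have hup : ∀ ε : ℝ, 0 < ε → ∃ π : Measure (Option E × Option E),
      π.map Prod.fst = cemeteryExtension μ ∧ π.map Prod.snd = cemeteryExtension ν ∧
      ∃ φ : E → ℝ, LipschitzWith 1 φ ∧ φ z0 = 0 ∧
        ∫ q, cemeteryDist z0 q.1 q.2 ∂π ≤
          (∫ z, φ z ∂μ - ∫ z, φ z ∂ν) + |(μ univ).toReal - (ν univ).toReal| + 5 * ε := by
    intro ε hε
    obtain ⟨T, ⟨hTμ, hTμε⟩, hTν, hTνε⟩ := exists_simpleFunc_integral_dist_le hμmom hνmom hε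
    let S : Option E → Option T.range := Option.map fun z => ⟨T z, T.mem_range_self z⟩
    let p : Option T.range → Option E := Option.map Subtype.val
    have hS : ∀ i, MeasurableSet (S ⁻¹' {i}) := by
      intro i
      rw [measurableSet_option_iff]
      rcases i with _ | ⟨y, hy⟩
      · simp [S, preimage]
      · convert T.measurableSet_fiber y using 1
        ext z
        simp [S]
    have hm : Measurable fun a => cemeteryDist z0 a (p (S a)) :=
      measurable_of_comp_some (measurable_id.dist T.measurable)
    obtain ⟨π, hπ1, hπ2, f, hf, hπf⟩ := exists_coupling_le_lipschitz_add (cemeteryDist z0)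
      (cemeteryDist_self z0) (cemeteryDist_comm z0) (cemeteryDist_triangle z0)
      (measurable_cemeteryDist z0) (cemeteryExtension μ) (cemeteryExtension ν) S hS p hε
      (integrable_cemeteryExtension hm hTμ)
      (by rw [integral_cemeteryExtension hμ hm hTμ]; simpa [S, p, cemeteryDist] using hTμε)
      (integrable_cemeteryExtension hm hTν)
      (by rw [integral_cemeteryExtension hν hm hTν]; simpa [S, p, cemeteryDist] using hTνε)
    have hlip : LipschitzWith 1 fun z => f (some z) :=
      LipschitzWith.of_le_add fun z w => by
        have := hf (some z) (some w)
        simp only [cemeteryDist] at this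
        linarith
    have hfm : Measurable f := measurable_of_comp_some hlip.continuous.measurable
    refine ⟨π, hπ1, hπ2, fun z => f (some z) - f (some z0), ?_, sub_self _, ?_⟩
    · exact LipschitzWith.of_le_add fun z w => by
        have := hf (some z) (some w)
        simp only [cemeteryDist] at this
        linarith
    · rw [integral_cemeteryExtension_sub hμ hν hfm (integrable_of_lipschitzWith_one hμmom hlip)
        (integrable_of_lipschitzWith_one hνmom hlip) (f (some z0))] at hπf
      have ht : |f (some z0) - f none| ≤ 1 := by
        have h1 := hf (some z0) none
        have h2 := hf none (some z0)
        simp only [cemeteryDist, dist_self, zero_add] at h1 h2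
        exact abs_le.2 ⟨by linarith, h1⟩
      have h3 : (f (some z0) - f none) * (μ.real univ - ν.real univ) ≤
          |μ.real univ - ν.real univ| :=
        (le_abs_self _).trans (by
          rw [abs_mul]
          exact mul_le_of_le_one_left (abs_nonneg _) ht)
      simp only [Measure.real] at h3 hπf
      linarith
  refine le_antisymm ?_ ?_
  · obtain ⟨π₀, hπ₀1, hπ₀2, -⟩ := hup 1 one_pos
    refine le_of_forall_pos_le_add fun δ hδ => ?_
    obtain ⟨π, hπ1, hπ2, φ, hφ, hφ0, hle⟩ := hup (δ / 5) (by positivity)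
    have h1 : wasserstein1 z0 (cemeteryExtension μ) (cemeteryExtension ν) ≤
        ∫ q, cemeteryDist z0 q.1 q.2 ∂π := by
      refine csInf_le ⟨0, ?_⟩ ⟨π, hπ1, hπ2, rfl⟩
      rintro r ⟨ρ, -, -, rfl⟩
      exact integral_nonneg fun q => cemeteryDist_nonneg _ _ _
    have h2 : ∫ z, φ z ∂μ - ∫ z, φ z ∂ν ≤ sSup {x | ∃ φ : E → ℝ, LipschitzWith 1 φ ∧ φ z0 = 0 ∧
        x = ∫ z, φ z ∂μ - ∫ z, φ z ∂ν} := by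
      refine le_csSup ⟨∫ q, cemeteryDist z0 q.1 q.2 ∂π₀, ?_⟩ ⟨φ, hφ, hφ0, rfl⟩
      rintro r ⟨φ', hφ', hφ'0, rfl⟩
      linarith [hlow φ' hφ' hφ'0 π₀ hπ₀1 hπ₀2, abs_nonneg ((μ univ).toReal - (ν univ).toReal)]
    linarith
  · obtain ⟨π₀, hπ₀1, hπ₀2, -⟩ := hup 1 one_pos
    refine le_csInf ⟨_, π₀, hπ₀1, hπ₀2, rfl⟩ ?_
    rintro r ⟨π, hπ1, hπ2, rfl⟩
    rw [← le_sub_iff_add_le]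
    refine csSup_le ⟨_, 0, LipschitzWith.const' 0, rfl, rfl⟩ ?_
    rintro x ⟨φ, hφ, hφ0, rfl⟩
    rw [le_sub_iff_add_le]
    exact hlow φ hφ hφ0 π hπ1 hπ2
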